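/- arXiv:1201.0931 — 2 statements merged into one kernel-verified Lean document; each statement's English description precedes it below -/
import Mathlib

section
/- Let k ≥ 1, a ≥ 1, b ≥ 0 and c ≥ 1 be integers, d := gcd(a, b), a' := a/d, b' := b/d, and let p be a prime with p ∤ d. Then for every positive integer n, v_p(g_{k,φ}(n)) = k·v_p(φ(d)) + Σ_{e≥2} max(0, #{m ∈ S_{k,a',b',c}(n) : p^e | m} − 1) + Σ_q max(0, #{m ∈ S_{k,a',b',c}(n) : q | m} − 1) · v_p(q − 1), where the last sum ranges over all primes q with q ∤ d and p | (q − 1). -/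
/-- `g_{k,φ} (n) = (∏_{i=0}^{k} φ (b + a (n + i c))) / φ (lcm_{0 ≤ i ≤ k} (b + a (n + i c)))`. -/
def gkphi (k a b c n : ℕ) : ℚ :=
  (∏ i ∈ Finset.range (k + 1), ((b + a * (n + i * c)).totient : ℚ)) /
    (((Finset.range (k + 1)).lcm fun i => b + a * (n + i * c)).totient : ℚ)

theorem padicValNat_finset_prod {ι : Type*} (p : ℕ) [Fact p.Prime] (s : Finset ι) (f : ι → ℕ)
    (hf : ∀ i ∈ s, f i ≠ 0) :
    padicValNat p (∏ i ∈ s, f i) = ∑ i ∈ s, padicValNat p (f i) := by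
  classical
  induction s using Finset.induction_on with
  | empty => simp
  | insert a s ha ih =>
    rw [Finset.prod_insert ha, Finset.sum_insert ha, padicValNat.mul (hf a (by simp))
      (Finset.prod_ne_zero_iff.mpr fun i hi => hf i (by simp [hi])),
      ih fun i hi => hf i (by simp [hi])]

theorem padicValNat_totient_add (p : ℕ) [hp : Fact p.Prime] (N : ℕ) (hN : N ≠ 0) :
    padicValNat p N.totient + (if p ∣ N then 1 else 0) =
      padicValNat p N + ∑ q ∈ N.primeFactors, padicValNat p (q - 1) := by
  have h := congrArg (padicValNat p) (Nat.totient_mul_prod_primeFactors N)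
  have h1 : ∀ q ∈ N.primeFactors, q ≠ 0 := fun q hq => (Nat.prime_of_mem_primeFactors hq).ne_zero
  have h2 : ∀ q ∈ N.primeFactors, q - 1 ≠ 0 := fun q hq =>
    Nat.sub_ne_zero_of_lt (Nat.prime_of_mem_primeFactors hq).one_lt
  rw [padicValNat.mul (Nat.totient_pos.mpr (Nat.pos_of_ne_zero hN)).ne'
      (Finset.prod_ne_zero_iff.mpr h1),
    padicValNat.mul hN (Finset.prod_ne_zero_iff.mpr h2), padicValNat_finset_prod _ _ _ h1,
    padicValNat_finset_prod _ _ _ h2] at h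
  rw [← h]
  congr 1
  have h3 : ∀ q ∈ N.primeFactors, padicValNat p q = if p = q then 1 else 0 := by
    intro q hq
    have := Fact.mk (Nat.prime_of_mem_primeFactors hq)
    split_ifs with hpq
    · subst hpq; exact padicValNat_self
    · exact padicValNat_primes hpq
  rw [Finset.sum_congr rfl h3]
  simp [Nat.mem_primeFactors, hp.out, hN]

theorem padicValNat_totient_eq_sum (p : ℕ) [hp : Fact p.Prime] (N B : ℕ) (hN : N ≠ 0)
    (hNB : N ≤ B) (P : Finset ℕ) (hP : ∀ q ∈ P, q.Prime) (hNP : N.primeFactors ⊆ P) :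
    padicValNat p N.totient =
      (∑ e ∈ Finset.Ico 2 (B + 2), if p ^ e ∣ N then 1 else 0) +
        ∑ q ∈ P, if q ∣ N then padicValNat p (q - 1) else 0 := by
  have h := padicValNat_totient_add p N hN
  have hv : padicValNat p N = ∑ e ∈ Finset.Ico 1 (B + 2), if p ^ e ∣ N then 1 else 0 := by
    rw [← Nat.factorization_def _ hp.out, Nat.factorization_eq_card_pow_dvd_of_lt hp.out
      (Nat.pos_of_ne_zero hN) (b := B + 2), Finset.card_filter]
    exact lt_of_lt_of_le (by lia) (Nat.lt_pow_self hp.out.one_lt).le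
  have hq : ∑ q ∈ N.primeFactors, padicValNat p (q - 1) =
      ∑ q ∈ P, if q ∣ N then padicValNat p (q - 1) else 0 := by
    rw [← Finset.sum_filter]
    refine Finset.sum_congr ?_ fun _ _ => rfl
    ext q
    simp only [Finset.mem_filter]
    exact ⟨fun h => ⟨hNP h, Nat.dvd_of_mem_primeFactors h⟩,
      fun h => Nat.mem_primeFactors.mpr ⟨hP q h.1, h.2, hN⟩⟩
  rw [hv, hq, Finset.sum_eq_sum_Ico_succ_bot (by lia), pow_one] at h
  lia

theorem padicValNat_totient_of_not_dvd (p : ℕ) [Fact p.Prime] (d : ℕ) (hpd : ¬ p ∣ d) :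
    padicValNat p d.totient = ∑ q ∈ d.primeFactors, padicValNat p (q - 1) := by
  have hd : d ≠ 0 := by rintro rfl; simp at hpd
  simpa [hpd, padicValNat.eq_zero_of_not_dvd] using padicValNat_totient_add p d hd

theorem Nat.Prime.pow_dvd_finset_lcm {ι : Type*} {p : ℕ} (hp : p.Prime) (e : ℕ) (s : Finset ι)
    (hs : s.Nonempty) (f : ι → ℕ) (hf : ∀ i ∈ s, f i ≠ 0) :
    p ^ e ∣ s.lcm f ↔ ∃ i ∈ s, p ^ e ∣ f i := by
  refine ⟨fun h => ?_, fun ⟨i, hi, h⟩ => h.trans (Finset.dvd_lcm hi)⟩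
  have hL : s.lcm f ≠ 0 := by
    rw [Ne, Finset.lcm_eq_zero_iff]
    rintro ⟨i, hi, h0⟩
    exact hf i hi h0
  rw [hp.pow_dvd_iff_le_factorization hL, Finset.factorization_lcm hf] at h
  obtain ⟨i, hi, heq⟩ := Finset.exists_mem_eq_sup s hs fun i => (f i).factorization p
  exact ⟨i, hi, (hp.pow_dvd_iff_le_factorization (hf i hi)).mpr (heq ▸ h)⟩

theorem sum_padicValNat_totient_eq {ι : Type*} (p : ℕ) [hp : Fact p.Prime] (s : Finset ι)
    (hs : s.Nonempty) (f : ι → ℕ) (hf : ∀ i ∈ s, f i ≠ 0) :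
    ∑ i ∈ s, padicValNat p (f i).totient =
      padicValNat p (s.lcm f).totient +
        ∑ e ∈ Finset.Ico 2 (s.lcm f + 2), ((s.filter fun i => p ^ e ∣ f i).card - 1) +
        ∑ q ∈ (s.lcm f).primeFactors,
          ((s.filter fun i => q ∣ f i).card - 1) * padicValNat p (q - 1) := by
  have hL : s.lcm f ≠ 0 := by
    rw [Ne, Finset.lcm_eq_zero_iff]
    rintro ⟨i, hi, h0⟩
    exact hf i hi h0
  have hP : ∀ q ∈ (s.lcm f).primeFactors, q.Prime := fun q => Nat.prime_of_mem_primeFactors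
  rw [padicValNat_totient_eq_sum p _ _ hL le_rfl _ hP subset_rfl,
    Finset.sum_congr rfl fun i hi => padicValNat_totient_eq_sum p (f i) (s.lcm f) (hf i hi)
      (Nat.le_of_dvd (Nat.pos_of_ne_zero hL) (Finset.dvd_lcm hi)) _ hP
      (Nat.primeFactors_mono (Finset.dvd_lcm hi) hL),
    Finset.sum_add_distrib, Finset.sum_comm, add_right_comm, add_assoc, add_comm (Finset.sum _ _)]
  have key : ∀ q e : ℕ, q.Prime → (s.filter fun i => q ^ e ∣ f i).card =
      (if q ^ e ∣ s.lcm f then 1 else 0) + ((s.filter fun i => q ^ e ∣ f i).card - 1) := by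
    intro q e hq
    split_ifs with h
    · obtain ⟨i, hi, hd⟩ := (hq.pow_dvd_finset_lcm e s hs f hf).mp h
      have : 0 < (s.filter fun i => q ^ e ∣ f i).card :=
        Finset.card_pos.mpr ⟨i, Finset.mem_filter.mpr ⟨hi, hd⟩⟩
      lia
    · have : (s.filter fun i => q ^ e ∣ f i).card = 0 := by
        rw [Finset.card_eq_zero, Finset.filter_eq_empty_iff]
        exact fun i hi hd => h (hd.trans (Finset.dvd_lcm hi))
      lia
  have h1 : ∑ e ∈ Finset.Ico 2 (s.lcm f + 2), ∑ i ∈ s, (if p ^ e ∣ f i then 1 else 0) =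
      ∑ e ∈ Finset.Ico 2 (s.lcm f + 2), (if p ^ e ∣ s.lcm f then 1 else 0) +
      ∑ e ∈ Finset.Ico 2 (s.lcm f + 2), ((s.filter fun i => p ^ e ∣ f i).card - 1) := by
    rw [← Finset.sum_add_distrib]
    refine Finset.sum_congr rfl fun e _ => ?_
    rw [← Finset.card_filter]
    exact key p e hp.out
  have h2 : ∑ i ∈ s, ∑ q ∈ (s.lcm f).primeFactors,
        (if q ∣ f i then padicValNat p (q - 1) else 0) =
      ∑ q ∈ (s.lcm f).primeFactors, (if q ∣ s.lcm f then padicValNat p (q - 1) else 0) +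
      ∑ q ∈ (s.lcm f).primeFactors,
        ((s.filter fun i => q ∣ f i).card - 1) * padicValNat p (q - 1) := by
    rw [Finset.sum_comm, ← Finset.sum_add_distrib]
    refine Finset.sum_congr rfl fun q hq => ?_
    have hk := key q 1 (hP q hq)
    have hd := Nat.dvd_of_mem_primeFactors hq
    simp only [pow_one, if_pos hd] at hk ⊢
    rw [← Finset.sum_filter, Finset.sum_const, smul_eq_mul]
    nth_rw 1 [hk]
    ring
  rw [h1, h2]
  ring

/-- Formula (3.1): for a prime `p ∤ d`, where `d = gcd (a, b)`, `a' = a / d`,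
`b' = b / d`, for all positive `n`:
`v_p (g_{k,φ} (n)) = k v_p (φ (d)) + Σ_{e ≥ 2} max (0, #{m ∈ S (n) : p^e ∣ m} − 1)
 + Σ_{q prime, q ∤ d, p ∣ q − 1} max (0, #{m ∈ S (n) : q ∣ m} − 1) ⬝ v_p (q − 1)`,
where `S (n) = {b' + a' (n + i c) : 0 ≤ i ≤ k}`. -/
theorem vp_gkphi_formula_not_dvd_d (k a b c : ℕ)
    (hk : 1 ≤ k) (ha : 1 ≤ a) (hc : 1 ≤ c)
    (d a' b' : ℕ) (hd : d = Nat.gcd a b) (ha' : a' = a / d) (hb' : b' = b / d)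
    (p : ℕ) (hp : p.Prime) (hpd : ¬ p ∣ d) :
    ∀ n : ℕ, 0 < n →
      padicValRat p (gkphi k a b c n) =
        (k : ℤ) * padicValNat p d.totient
        + ((∑ᶠ (e : ℕ) (_ : 2 ≤ e),
            (((Finset.range (k + 1)).filter
                fun i => p ^ e ∣ b' + a' * (n + i * c)).card - 1) : ℕ) : ℤ)
        + ((∑ᶠ (q : ℕ) (_ : q.Prime ∧ ¬ q ∣ d ∧ p ∣ (q - 1)),
            ((((Finset.range (k + 1)).filter
                fun i => q ∣ b' + a' * (n + i * c)).card - 1)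
              * padicValNat p (q - 1)) : ℕ) : ℤ) := by
  intro n hn
  have : Fact p.Prime := ⟨hp⟩
  set s := Finset.range (k + 1) with hs
  have hsne : s.Nonempty := ⟨0, by simp [hs]⟩
  set f : ℕ → ℕ := fun i => b + a * (n + i * c) with hf_def
  have hf : ∀ i ∈ s, f i ≠ 0 := fun i _ =>
    (Nat.add_pos_right b (Nat.mul_pos ha (Nat.add_pos_left hn _))).ne'
  have hfd : ∀ i, f i = d * (b' + a' * (n + i * c)) := by
    intro i
    have h1 : d * a' = a := ha' ▸ Nat.mul_div_cancel' (hd ▸ Nat.gcd_dvd_left a b)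
    have h2 : d * b' = b := hb' ▸ Nat.mul_div_cancel' (hd ▸ Nat.gcd_dvd_right a b)
    simp only [hf_def]
    rw [mul_add d, ← mul_assoc d, h1, h2]
  have hd0 : d ≠ 0 := by rintro rfl; simp at hpd
  set L := s.lcm f with hL_def
  have hL : L ≠ 0 := by
    rw [Ne, hL_def, Finset.lcm_eq_zero_iff]
    rintro ⟨i, hi, h0⟩
    exact hf i hi h0
  have hdL : d ∣ L := (Dvd.intro _ (hfd 0).symm).trans (Finset.dvd_lcm (by simp [hs]))
  have hpow : ∀ e i, p ^ e ∣ f i ↔ p ^ e ∣ b' + a' * (n + i * c) := fun e i => by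
    rw [hfd]
    exact ((hp.coprime_iff_not_dvd.mpr hpd).pow_left e).dvd_mul_left
  have hq : ∀ q : ℕ, q.Prime → ¬ q ∣ d → ∀ i, q ∣ f i ↔ q ∣ b' + a' * (n + i * c) :=
    fun q hq hqd i => by
      rw [hfd]
      exact (hq.coprime_iff_not_dvd.mpr hqd).dvd_mul_left
  have hval : padicValRat p (gkphi k a b c n) =
      ((∑ i ∈ s, padicValNat p (f i).totient : ℕ) : ℤ) - (padicValNat p L.totient : ℤ) := by
    have hφ : ∀ i ∈ s, (f i).totient ≠ 0 := fun i hi =>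
      (Nat.totient_pos.mpr (Nat.pos_of_ne_zero (hf i hi))).ne'
    have hg : gkphi k a b c n =
        ((∏ i ∈ s, (f i).totient : ℕ) : ℚ) / ((L.totient : ℕ) : ℚ) := by
      rw [Nat.cast_prod]; rfl
    rw [hg, padicValRat.div
      (Nat.cast_ne_zero.mpr (Finset.prod_ne_zero_iff.mpr hφ))
      (Nat.cast_ne_zero.mpr (Nat.totient_pos.mpr (Nat.pos_of_ne_zero hL)).ne'),
      padicValRat.of_nat, padicValRat.of_nat, padicValNat_finset_prod p s _ hφ]
  have hE : ∑ᶠ (e : ℕ) (_ : 2 ≤ e),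
      ((s.filter fun i => p ^ e ∣ b' + a' * (n + i * c)).card - 1) =
      ∑ e ∈ Finset.Ico 2 (L + 2), ((s.filter fun i => p ^ e ∣ f i).card - 1) := by
    simp only [← hpow]
    refine finsum_cond_eq_sum_of_cond_iff _ fun {e} he => ?_
    rw [Finset.mem_Ico]
    refine ⟨fun h => ⟨h, ?_⟩, fun h => h.1⟩
    obtain ⟨i, hi⟩ := Finset.card_pos.mp (by lia : 0 < (s.filter fun i => p ^ e ∣ f i).card)
    rw [Finset.mem_filter] at hi
    have h1 := Nat.le_of_dvd (Nat.pos_of_ne_zero hL) (hi.2.trans (Finset.dvd_lcm hi.1))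
    have h2 : e < p ^ e := Nat.lt_pow_self hp.one_lt
    lia
  have hQ : ∑ᶠ (q : ℕ) (_ : q.Prime ∧ ¬ q ∣ d ∧ p ∣ (q - 1)),
      ((s.filter fun i => q ∣ b' + a' * (n + i * c)).card - 1) * padicValNat p (q - 1) =
      ∑ q ∈ L.primeFactors with ¬ q ∣ d,
        ((s.filter fun i => q ∣ f i).card - 1) * padicValNat p (q - 1) := by
    have hS : ∑ q ∈ L.primeFactors with ¬ q ∣ d,
          ((s.filter fun i => q ∣ f i).card - 1) * padicValNat p (q - 1) =
        ∑ q ∈ L.primeFactors with ¬ q ∣ d,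
          ((s.filter fun i => q ∣ b' + a' * (n + i * c)).card - 1) * padicValNat p (q - 1) := by
      refine Finset.sum_congr rfl fun q hq' => ?_
      rw [Finset.mem_filter] at hq'
      simp only [hq q (Nat.prime_of_mem_primeFactors hq'.1) hq'.2]
    rw [hS]
    refine finsum_cond_eq_sum_of_cond_iff _ fun {q} h0 => ?_
    rw [Finset.mem_filter, Nat.mem_primeFactors]
    obtain ⟨h1, h2⟩ := mul_ne_zero_iff.mp h0
    refine ⟨fun h => ⟨⟨h.1, ?_, hL⟩, h.2.1⟩, fun h => ⟨h.1.1, h.2, ?_⟩⟩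
    · obtain ⟨i, hi⟩ := Finset.card_pos.mp
        (by lia : 0 < (s.filter fun i => q ∣ b' + a' * (n + i * c)).card)
      rw [Finset.mem_filter, ← hq q h.1 h.2.1] at hi
      exact hi.2.trans (Finset.dvd_lcm hi.1)
    · by_contra hpq
      exact h2 (padicValNat.eq_zero_of_not_dvd hpq)
  have hD : ∑ q ∈ L.primeFactors with q ∣ d,
      ((s.filter fun i => q ∣ f i).card - 1) * padicValNat p (q - 1) =
      k * padicValNat p d.totient := by
    rw [padicValNat_totient_of_not_dvd p d hpd, Finset.mul_sum]
    refine Finset.sum_congr ?_ fun q hq => ?_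
    · ext q
      simp only [Finset.mem_filter, Nat.mem_primeFactors]
      exact ⟨fun h => ⟨h.1.1, h.2, hd0⟩, fun h => ⟨⟨h.1, h.2.1.trans hdL, hL⟩, h.2.1⟩⟩
    · rw [Finset.filter_true_of_mem fun i _ =>
        (Nat.dvd_of_mem_primeFactors hq).trans (Dvd.intro _ (hfd i).symm)]
      simp [hs]
  have hmain := sum_padicValNat_totient_eq p s hsne f hf
  rw [← Finset.sum_filter_add_sum_filter_not L.primeFactors (fun q => q ∣ d), hD] at hmain
  rw [hval, hE, hQ, hmain]
  push_cast
  ring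
end

section
/- Let k ≥ 1, a ≥ 1, b ≥ 0 and c ≥ 1 be integers, d := gcd(a, b), a' := a/d, and let p be a prime such that p | c·L_k, p ∤ a' and p ∤ d. Then the smallest period of g_{p,k,φ} is P_{p,k,φ} = p^{e(p,k)} · (∏_{q ∈ A} q) · (∏_{q ∈ B} q), where A is the set of primes q with q ∤ ac, q | L_k, p | (q − 1) and k + 1 ≢ 0 (mod q), B is the set of primes q with q ∤ a, q | c and p | (q − 1), and e(p,k) := 0 if v_p(c·L_k) = 1; e(p,k) := v_p(c) if v_p(k+1) ≥ v_p(L_k) and v_p(c·L_k) ≥ 2; and e(p,k) := v_p(c·L_k) if v_p(k+1) < v_p(L_k) and v_p(c·L_k) ≥ 2. -/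
/-- `L k = lcm (1, 2, …, k)`. -/
def Lk (k : ℕ) : ℕ := (Finset.Icc 1 k).lcm id

open Finset

/-- The `p`-adic valuation of `φ x`, as a sum over prime powers dividing `x`. -/
theorem factorization_totient_eq_sum {p x M : ℕ} (hp : p.Prime) (hx : x ≠ 0) (hM : x ≤ M) :
    x.totient.factorization p = ∑ t ∈ Icc 2 M, (if p ^ t ∣ x then 1 else 0) +
      ∑ q ∈ (Icc 1 M).filter Nat.Prime, (q - 1).factorization p * (if q ∣ x then 1 else 0) := by
  have h1 : ∑ t ∈ Icc 2 M, (if p ^ t ∣ x then 1 else 0) = x.factorization p - 1 := by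
    rw [← card_filter]
    have : (Icc 2 M).filter (fun t => p ^ t ∣ x) = Icc 2 (x.factorization p) := by
      ext t
      simp only [mem_filter, mem_Icc, hp.pow_dvd_iff_le_factorization hx]
      have := Nat.factorization_lt p hx
      omega
    rw [this, Nat.card_Icc]
    omega
  have h2 : ∑ q ∈ (Icc 1 M).filter Nat.Prime, (q - 1).factorization p * (if q ∣ x then 1 else 0) =
      ∑ q ∈ x.primeFactors, (q - 1).factorization p := by
    simp only [mul_ite, mul_one, mul_zero]
    rw [← sum_filter, filter_filter]
    refine sum_congr ?_ fun _ _ => rfl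
    ext q
    simp only [mem_filter, mem_Icc, Nat.mem_primeFactors]
    constructor
    · rintro ⟨_, h1, h2⟩
      exact ⟨h1, h2, hx⟩
    · rintro ⟨h1, h2, _⟩
      exact ⟨⟨h1.one_le, (Nat.le_of_dvd (Nat.pos_of_ne_zero hx) h2).trans hM⟩, h1, h2⟩
  have h3 : ∀ q ∈ x.primeFactors, q ^ (x.factorization q - 1) * (q - 1) ≠ 0 := by
    intro q hq
    have := (Nat.prime_of_mem_primeFactors hq).two_le
    exact mul_ne_zero (pow_ne_zero _ (by omega)) (by omega)
  rw [h1, h2, Nat.totient_eq_prod_factorization hx, Nat.prod_factorization_eq_prod_primeFactors,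
    Nat.factorization_prod_apply h3]
  have h4 : ∀ q ∈ x.primeFactors, (q ^ (x.factorization q - 1) * (q - 1)).factorization p =
      (if q = p then x.factorization p - 1 else 0) + (q - 1).factorization p := by
    intro q hq
    have hq' := Nat.prime_of_mem_primeFactors hq
    rw [Nat.factorization_mul (left_ne_zero_of_mul (h3 q hq)) (right_ne_zero_of_mul (h3 q hq)),
      hq'.factorization_pow, Finsupp.add_apply, Finsupp.single_apply]
    split_ifs with h
    · rw [h]
    · rfl
  rw [sum_congr rfl h4, sum_add_distrib, sum_ite_eq']
  congr 1
  split_ifs with h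
  · rfl
  · rw [← Nat.support_factorization, Finsupp.notMem_support_iff] at h
    simp [h]

theorem Nat.Prime.pow_dvd_finset_lcm_iff {ι : Type*} {q t : ℕ} (hq : q.Prime) (ht : t ≠ 0)
    (s : Finset ι) (x : ι → ℕ) (hx : ∀ i ∈ s, x i ≠ 0) :
    q ^ t ∣ s.lcm x ↔ ∃ i ∈ s, q ^ t ∣ x i := by
  constructor
  · classical
    induction s using Finset.induction_on with
    | empty => simp [hq.ne_one, ht]
    | insert j s hj ih =>
      intro h
      have h1 : x j ≠ 0 := hx j (mem_insert_self _ _)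
      have hs : ∀ i ∈ s, x i ≠ 0 := fun i hi => hx i (mem_insert_of_mem hi)
      have h2 : s.lcm x ≠ 0 := by
        rw [Ne, Finset.lcm_eq_zero_iff]
        rintro ⟨i, hi, hi0⟩
        exact hs i hi hi0
      have h3 : Nat.lcm (x j) (s.lcm x) ≠ 0 := Nat.lcm_ne_zero h1 h2
      rw [Finset.lcm_insert, lcm_eq_nat_lcm, hq.pow_dvd_iff_le_factorization h3,
        Nat.factorization_lcm h1 h2, Finsupp.sup_apply, le_sup_iff,
        ← hq.pow_dvd_iff_le_factorization h1, ← hq.pow_dvd_iff_le_factorization h2] at h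
      rcases h with h | h
      · exact ⟨j, mem_insert_self _ _, h⟩
      · obtain ⟨i, hi, h⟩ := ih hs h
        exact ⟨i, mem_insert_of_mem hi, h⟩
  · rintro ⟨i, hi, h⟩
    exact h.trans (Finset.dvd_lcm hi)

/-- The sum of the valuations of the `φ (x i)` exceeds that of `φ (lcm x)` by a sum, over prime
powers, of the truncated numbers of indices at which they divide. -/
theorem sum_factorization_totient_eq {ι : Type*} {p M : ℕ} (hp : p.Prime) (s : Finset ι)
    (x : ι → ℕ) (hx : ∀ i ∈ s, x i ≠ 0) (hM : s.lcm x ≤ M) :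
    ∑ i ∈ s, (x i).totient.factorization p = (s.lcm x).totient.factorization p +
      (∑ t ∈ Icc 2 M, (#{i ∈ s | p ^ t ∣ x i} - 1) +
        ∑ q ∈ (Icc 1 M).filter Nat.Prime,
          (q - 1).factorization p * (#{i ∈ s | q ∣ x i} - 1)) := by
  have h0 : s.lcm x ≠ 0 := by
    rw [Ne, Finset.lcm_eq_zero_iff]
    rintro ⟨i, hi, hi0⟩
    exact hx i hi hi0
  have key : ∀ q t : ℕ, q.Prime → t ≠ 0 → ∑ i ∈ s, (if q ^ t ∣ x i then 1 else 0) =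
      (if q ^ t ∣ s.lcm x then 1 else 0) + (#{i ∈ s | q ^ t ∣ x i} - 1) := by
    intro q t hq ht
    rw [← card_filter]
    have : q ^ t ∣ s.lcm x ↔ 0 < #{i ∈ s | q ^ t ∣ x i} := by
      rw [hq.pow_dvd_finset_lcm_iff ht s x hx, card_pos, filter_nonempty_iff]
    split_ifs with h <;> rw [this] at h <;> omega
  rw [factorization_totient_eq_sum hp h0 hM,
    sum_congr rfl fun i hi => factorization_totient_eq_sum hp (hx i hi)
      ((Nat.le_of_dvd (Nat.pos_of_ne_zero h0) (Finset.dvd_lcm hi)).trans hM),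
    sum_add_distrib, sum_comm, sum_comm (s := s), add_add_add_comm, ← sum_add_distrib,
    ← sum_add_distrib]
  congr 1
  · refine sum_congr rfl fun t ht => key p t hp ?_
    have := (mem_Icc.1 ht).1
    omega
  · refine sum_congr rfl fun q hq => ?_
    have := key q 1 (mem_filter.1 hq).2 one_ne_zero
    rw [pow_one] at this
    rw [← mul_sum, this, mul_add]

/-- The number of indices `i ≤ k` such that `P` divides `b + a * (n + i * c)`. -/
def hits (k a b c P n : ℕ) : ℕ :=
  #{i ∈ range (k + 1) | P ∣ b + a * (n + i * c)}

/-- The number of hits beyond the first one. -/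
def excess (k a b c P n : ℕ) : ℕ :=
  hits k a b c P n - 1

theorem dvd_Lk {i k : ℕ} (hi : 1 ≤ i) (hik : i ≤ k) : i ∣ Lk k :=
  Finset.dvd_lcm (f := id) (mem_Icc.2 ⟨hi, hik⟩)

theorem Lk_ne_zero (k : ℕ) : Lk k ≠ 0 := by
  rw [Lk, Ne, Finset.lcm_eq_zero_iff]
  rintro ⟨i, hi, hi0⟩
  have := (mem_Icc.1 hi).1
  simp only [id] at hi0
  omega

theorem le_of_prime_pow_dvd_Lk {q t k : ℕ} (hq : q.Prime) (ht : t ≠ 0) (h : q ^ t ∣ Lk k) :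
    q ^ t ≤ k := by
  obtain ⟨i, hi, hqi⟩ := (hq.pow_dvd_finset_lcm_iff ht _ _
    (fun i hi => by have := (mem_Icc.1 hi).1; simp only [id]; omega)).1 h
  have := mem_Icc.1 hi
  exact (Nat.le_of_dvd this.1 hqi).trans this.2

theorem Function.Periodic.of_dvd {α : Type*} {f : ℕ → α} {c T : ℕ} (h : Function.Periodic f c)
    (hc : c ∣ T) : Function.Periodic f T := by
  obtain ⟨e, rfl⟩ := hc
  rw [mul_comm]
  exact h.nat_mul e

theorem Function.Periodic.finset_sum {ι : Type*} {s : Finset ι} {f : ι → ℕ → ℕ} {T : ℕ}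
    (h : ∀ i ∈ s, Function.Periodic (f i) T) : Function.Periodic (fun n => ∑ i ∈ s, f i n) T :=
  fun n => sum_congr rfl fun i hi => h i hi n

theorem periodic_excess_of_dvd {k a b c P T : ℕ} (h : P ∣ a * T) :
    Function.Periodic (excess k a b c P) T := by
  intro n
  unfold excess hits
  congr 2
  refine filter_congr fun i _ => ?_
  rw [show b + a * (n + T + i * c) = b + a * (n + i * c) + a * T by ring, Nat.dvd_add_left h]

theorem excess_eq_zero_of_not_dvd {k a b c P : ℕ} (ha : P.Coprime a) (h : ¬ P ∣ c * Lk k) (n : ℕ) :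
    excess k a b c P n = 0 := by
  have main : ∀ i j : ℕ, i < j → j ≤ k → P ∣ b + a * (n + i * c) → P ∣ b + a * (n + j * c) →
      False := by
    intro i j hij hj hi hj'
    apply h
    have h1 : b + a * (n + j * c) = b + a * (n + i * c) + a * (c * (j - i)) := by
      obtain ⟨e, rfl⟩ := Nat.exists_eq_add_of_lt hij
      rw [show i + e + 1 - i = e + 1 by omega]
      ring
    rw [h1] at hj'
    exact (ha.dvd_of_dvd_mul_left ((Nat.dvd_add_right hi).1 hj')).trans
      (mul_dvd_mul_left c (dvd_Lk (by omega) (by omega)))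
  have : hits k a b c P n ≤ 1 := by
    refine card_le_one.2 fun i hi j hj => ?_
    simp only [mem_filter, mem_range] at hi hj
    rcases lt_trichotomy i j with h1 | h1 | h1
    · exact (main i j h1 (by omega) hi.2 hj.2).elim
    · exact h1
    · exact (main j i h1 (by omega) hj.2 hi.2).elim
  unfold excess
  omega

theorem padicValRat_gkphi {k a b c p n : ℕ} (hp : p.Prime) (ha : 1 ≤ a) (hc : 1 ≤ c)
    (hpa : ¬ p ∣ a) (hn : 0 < n) :
    padicValRat p (gkphi k a b c n) =
      ((∑ t ∈ Icc 2 (padicValNat p (c * Lk k)), excess k a b c (p ^ t) n +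
        ∑ q ∈ (a * c * Lk k).primeFactors,
          (q - 1).factorization p * excess k a b c q n : ℕ) : ℤ) := by
  have := Fact.mk hp
  set x : ℕ → ℕ := fun i => b + a * (n + i * c) with hxdef
  have hx : ∀ i ∈ range (k + 1), x i ≠ 0 := fun i _ => by
    simp only [hxdef]
    positivity
  have hl0 : (range (k + 1)).lcm x ≠ 0 := by
    rw [Ne, Finset.lcm_eq_zero_iff]
    rintro ⟨i, hi, hi0⟩
    exact hx i hi hi0
  have hcL : c * Lk k ≠ 0 := mul_ne_zero (by omega) (Lk_ne_zero k)
  have haL : a * c * Lk k ≠ 0 := by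
    rw [mul_assoc]
    exact mul_ne_zero (by omega) hcL
  have hle : c * Lk k ≤ a * c * Lk k := by
    rw [mul_assoc]
    exact Nat.le_mul_of_pos_left _ ha
  obtain ⟨M, hM1, hM2⟩ : ∃ M, (range (k + 1)).lcm x ≤ M ∧ a * c * Lk k ≤ M :=
    ⟨_, le_max_left _ _, le_max_right _ _⟩
  have main := sum_factorization_totient_eq hp (range (k + 1)) x hx hM1
  have e1 : ∑ t ∈ Icc 2 (padicValNat p (c * Lk k)), excess k a b c (p ^ t) n =
      ∑ t ∈ Icc 2 M, excess k a b c (p ^ t) n := by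
    refine sum_subset (Icc_subset_Icc_right ?_) fun t ht ht' => ?_
    · rw [← Nat.factorization_def _ hp]
      exact ((Nat.factorization_lt p hcL).le.trans hle).trans hM2
    · refine excess_eq_zero_of_not_dvd
        (Nat.Coprime.pow_left _ ((Nat.Prime.coprime_iff_not_dvd hp).2 hpa)) ?_ n
      rw [padicValNat_dvd_iff_le hcL]
      simp only [mem_Icc] at ht ht'
      omega
  have e2 : ∑ q ∈ (a * c * Lk k).primeFactors, (q - 1).factorization p * excess k a b c q n =
      ∑ q ∈ (Icc 1 M).filter Nat.Prime, (q - 1).factorization p * excess k a b c q n := by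
    refine sum_subset (fun q hq => ?_) fun q hq hq' => ?_
    · have h := Nat.prime_of_mem_primeFactors hq
      exact mem_filter.2 ⟨mem_Icc.2 ⟨h.one_le, (Nat.le_of_mem_primeFactors hq).trans hM2⟩, h⟩
    · have hqp := (mem_filter.1 hq).2
      have hnd : ¬ q ∣ a * c * Lk k := fun h => hq' (Nat.mem_primeFactors.2 ⟨hqp, h, haL⟩)
      rw [mul_assoc] at hnd
      rw [excess_eq_zero_of_not_dvd ((Nat.Prime.coprime_iff_not_dvd hqp).2
        fun h => hnd (h.mul_right _)) (fun h => hnd (h.mul_left _)), mul_zero]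
  rw [e1, e2]
  have hφ : ∀ i ∈ range (k + 1), (x i).totient ≠ 0 := fun i hi =>
    (Nat.totient_pos.2 (Nat.pos_of_ne_zero (hx i hi))).ne'
  have hg : gkphi k a b c n = ((∏ i ∈ range (k + 1), (x i).totient : ℕ) : ℚ) /
      (((range (k + 1)).lcm x).totient : ℚ) := by
    rw [Nat.cast_prod]
    rfl
  rw [hg, padicValRat.div (Nat.cast_ne_zero.2 (prod_ne_zero_iff.2 hφ))
    (Nat.cast_ne_zero.2 (Nat.totient_pos.2 (Nat.pos_of_ne_zero hl0)).ne'),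
    padicValRat.of_nat, padicValRat.of_nat, ← Nat.factorization_def _ hp,
    ← Nat.factorization_def _ hp, Nat.factorization_prod_apply hφ, main]
  push_cast
  rw [add_sub_cancel_left]
  rfl

theorem Nat.Coprime.exists_dvd_add_mul {a P : ℕ} (h : P.Coprime a) (hP : P ≠ 0) (b : ℕ) :
    ∃ n, P ∣ b + a * n := by
  obtain ⟨n, -, hn⟩ := Nat.exists_mul_mod_eq_of_coprime (b * (P - 1)) h.symm hP
  refine ⟨n, ?_⟩
  have h1 : b + a * n ≡ b + b * (P - 1) [MOD P] := Nat.ModEq.add_left b hn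
  rw [(h1.dvd_iff dvd_rfl)]
  obtain ⟨P, rfl⟩ := Nat.exists_eq_succ_of_ne_zero hP
  exact ⟨b, by rw [Nat.succ_sub_one, Nat.succ_eq_add_one]; ring⟩

/-- When `v` is a hit, the hits are the indices congruent to `v`. -/
theorem hits_eq_of_dvd_add {k a b c D Q u n v : ℕ} (hc : c = D * u) (hD : 0 < D) (hQ : 0 < Q)
    (hau : Q.Coprime (a * u)) (hv : D * Q ∣ b + a * (n + v * c)) :
    hits k a b c (D * Q) n = (k + 1) / Q + if v % Q < (k + 1) % Q then 1 else 0 := by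
  rw [← Nat.count_modEq_card (k + 1) hQ v, Nat.count_eq_card_filter_range]
  unfold hits
  congr 1
  refine filter_congr fun i _ => ?_
  have h1 : D * Q ∣ b + a * (n + i * c) ↔ ((D * Q : ℕ) : ℤ) ∣ (D : ℤ) * ((a * u : ℕ) * (i - v)) := by
    rw [← Int.natCast_dvd_natCast]
    have h2 : ((b + a * (n + i * c) : ℕ) : ℤ) =
        (b + a * (n + v * c) : ℕ) + D * ((a * u : ℕ) * (i - v)) := by
      subst hc
      push_cast
      ring
    rw [h2, dvd_add_right (Int.natCast_dvd_natCast.2 hv)]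
  rw [h1, Nat.cast_mul, mul_dvd_mul_iff_left (by exact_mod_cast hD.ne'),
    Nat.ModEq.comm, Nat.modEq_iff_dvd]
  exact ⟨(Nat.isCoprime_iff_coprime.2 hau).dvd_of_dvd_mul_left, fun h => h.mul_left _⟩

theorem hits_eq_of_dvd_succ {k a b c D Q u n : ℕ} (hc : c = D * u) (hD : 0 < D) (hQ : 0 < Q)
    (hau : Q.Coprime (a * u)) (hk : Q ∣ k + 1) :
    hits k a b c (D * Q) n = if D ∣ b + a * n then (k + 1) / Q else 0 := by
  split_ifs with h
  · obtain ⟨y, hy⟩ := h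
    obtain ⟨v, w, hv⟩ := hau.exists_dvd_add_mul hQ.ne' y
    rw [hits_eq_of_dvd_add (v := v) hc hD hQ hau ⟨w, ?_⟩]
    · simp [Nat.mod_eq_zero_of_dvd hk]
    · rw [mul_assoc, ← hv, hc, mul_add, mul_add, ← add_assoc, hy]
      ring
  · refine card_eq_zero.2 (filter_eq_empty_iff.2 fun i _ hi => h ?_)
    have h1 := (dvd_mul_right D Q).trans hi
    rw [mul_add, ← add_assoc, hc] at h1
    exact (Nat.dvd_add_left ⟨a * i * u, by ring⟩).1 h1

theorem periodic_excess_of_dvd_succ {k a b c D Q u : ℕ} (hc : c = D * u) (hD : 0 < D) (hQ : 0 < Q)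
    (hau : Q.Coprime (a * u)) (hk : Q ∣ k + 1) :
    Function.Periodic (excess k a b c (D * Q)) D := by
  intro n
  unfold excess
  rw [hits_eq_of_dvd_succ hc hD hQ hau hk, hits_eq_of_dvd_succ hc hD hQ hau hk, mul_add,
    ← add_assoc]
  simp only [Nat.dvd_add_left (Dvd.intro_left a rfl : D ∣ a * D)]

theorem not_periodic_excess {k a b c D u R r : ℕ} (hc : c = D * u) (hD : 0 < D) (hR : 0 < R)
    (hr : 2 ≤ r) (hau : (R * r).Coprime (a * u)) (ha : (D * (R * r)).Coprime a) (hk : R * r ≤ k)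
    (hk' : ¬ R * r ∣ k + 1) : ¬ Function.Periodic (excess k a b c (D * (R * r))) (D * R) := by
  intro h
  have hQR : 2 * R ≤ R * r := by nlinarith
  generalize R * r = Q at *
  have hQ : 0 < Q := by omega
  obtain ⟨n, hn⟩ := ha.exists_dvd_add_mul (by positivity) b
  have key : ∀ w v : ℕ, Q ∣ w + v → hits k a b c (D * Q) (n + c * w) =
      (k + 1) / Q + if v % Q < (k + 1) % Q then 1 else 0 := by
    rintro w v ⟨e, he⟩
    refine hits_eq_of_dvd_add hc hD hQ hau ?_
    rw [show b + a * (n + c * w + v * c) = b + a * n + a * c * (w + v) by ring, he]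
    exact dvd_add hn ⟨a * u * e, by rw [hc]; ring⟩
  have hper : ∀ w, excess k a b c (D * Q) (n + c * (w + R)) =
      excess k a b c (D * Q) (n + c * w) := by
    intro w
    rw [show n + c * (w + R) = n + c * w + D * R * u by rw [hc]; ring]
    exact h.of_dvd (dvd_mul_right _ _) _
  have hdiv : 1 ≤ (k + 1) / Q := (Nat.one_le_div_iff hQ).2 (by omega)
  have hmod : 0 < (k + 1) % Q := Nat.pos_of_ne_zero fun h => hk' (Nat.dvd_of_mod_eq_zero h)
  have hlt := Nat.mod_lt (k + 1) hQ
  have p0 := hper 0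
  have p1 := hper 1
  unfold excess at p0 p1
  rw [key 0 0 (by simp), key (0 + R) (Q - R) (by rw [show 0 + R + (Q - R) = Q by omega]),
    Nat.mod_eq_of_lt (show Q - R < Q by omega), Nat.zero_mod, if_pos hmod] at p0
  rw [key 1 (Q - 1) (by rw [show 1 + (Q - 1) = Q by omega]),
    key (1 + R) (Q - 1 - R) (by rw [show 1 + R + (Q - 1 - R) = Q by omega]),
    Nat.mod_eq_of_lt (show Q - 1 - R < Q by omega), Nat.mod_eq_of_lt (show Q - 1 < Q by omega)] at p1
  split_ifs at p0 p1 <;> omega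

theorem hits_eq_zero_of_not_dvd {k a b c P n : ℕ} (hc : P ∣ c) (h : ¬ P ∣ b + a * n) :
    hits k a b c P n = 0 := by
  refine card_eq_zero.2 (filter_eq_empty_iff.2 fun i _ hi => h ?_)
  rw [mul_add, ← add_assoc] at hi
  exact (Nat.dvd_add_left ((hc.mul_left i).mul_left a)).1 hi

theorem one_le_excess {k a b c P n j : ℕ} (hj : 1 ≤ j) (hjk : j ≤ k) (h : P ∣ b + a * n)
    (hc : P ∣ j * c) : 1 ≤ excess k a b c P n := by
  have : 1 < hits k a b c P n := by
    refine one_lt_card.2 ⟨0, ?_, j, ?_, by omega⟩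
    · simpa using h
    · simp only [mem_filter, mem_range]
      refine ⟨by omega, ?_⟩
      rw [mul_add, ← add_assoc]
      exact dvd_add h (hc.mul_left a)
  unfold excess
  omega

/-- A summand whose period `r ^ (s + 1)` is coprime to that of the other summand. -/
theorem Function.Periodic.of_add_of_coprime {F R : ℕ → ℕ} {T M r s : ℕ} (hr : r.Prime)
    (hF : Function.Periodic F (r ^ (s + 1))) (hR : Function.Periodic R M) (hM : r.Coprime M)
    (hG : Function.Periodic (fun n => F n + R n) T) (hT : ¬ r ^ (s + 1) ∣ T) :
    Function.Periodic F (r ^ s) := by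
  have hTM : Function.Periodic F (T * M) := by
    intro n
    have h1 : F (n + T * M) + R (n + T * M) = F n + R n := hG.of_dvd (dvd_mul_right T M) n
    have h2 := hR.of_dvd (dvd_mul_left M T) n
    omega
  obtain ⟨j, hj, hg⟩ := (Nat.dvd_prime_pow hr).1 (Nat.gcd_dvd_right (T * M) (r ^ (s + 1)))
  have hjs : j ≤ s := by
    by_contra hjs
    obtain rfl : j = s + 1 := by omega
    exact hT (Nat.Coprime.dvd_of_dvd_mul_right (hM.pow_left _) (hg ▸ Nat.gcd_dvd_left _ _))
  have hlt : (T * M).gcd (r ^ (s + 1)) < r ^ (s + 1) := by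
    rw [hg]
    exact Nat.pow_lt_pow_right hr.one_lt (by omega)
  obtain ⟨m, -, hm⟩ := Nat.exists_mul_mod_eq_gcd hlt
  rw [hg] at hm
  have hFj : Function.Periodic F (r ^ j) := by
    intro n
    have h1 := hTM.of_dvd (dvd_mul_right _ m) n
    rw [← Nat.mod_add_div (T * M * m) (r ^ (s + 1)), hm, ← add_assoc,
      hF.of_dvd (dvd_mul_right _ _)] at h1
    exact h1
  exact hFj.of_dvd (pow_dvd_pow r hjs)

theorem periodic_sum_excess_prime_pow {k a b c p m u : ℕ} (hp : p.Prime) (hpa : ¬ p ∣ a)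
    (hpu : ¬ p ∣ u) (hc : c = p ^ m * u) :
    Function.Periodic
      (fun n => ∑ t ∈ Icc 2 (m + padicValNat p (Lk k)), excess k a b c (p ^ t) n)
      (p ^ (if m + padicValNat p (Lk k) = 1 then 0
        else if padicValNat p (Lk k) ≤ padicValNat p (k + 1) then m
        else m + padicValNat p (Lk k))) := by
  have := Fact.mk hp
  refine Function.Periodic.finset_sum fun t ht => ?_
  obtain ⟨ht2, htV⟩ := mem_Icc.1 ht
  rw [if_neg (by omega)]
  split_ifs with h
  · rcases le_or_gt t m with htm | htm
    · exact periodic_excess_of_dvd ((pow_dvd_pow p htm).mul_left a)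
    · obtain ⟨s, rfl⟩ := Nat.exists_eq_add_of_lt htm
      rw [add_assoc, pow_add]
      refine periodic_excess_of_dvd_succ hc (pow_pos hp.pos _) (pow_pos hp.pos _)
        (Nat.Coprime.pow_left _ ((Nat.Prime.coprime_iff_not_dvd hp).2 (hp.not_dvd_mul hpa hpu))) ?_
      rw [padicValNat_dvd_iff_le (by omega)]
      omega
  · exact periodic_excess_of_dvd ((pow_dvd_pow p htV).mul_left a)

theorem not_periodic_sum_excess_of_le {k a b c p s l : ℕ} (hk : 1 ≤ k) (hp : p.Prime)
    (hpa : ¬ p ∣ a) (hc : p ^ (s + 1) ∣ c) (hl : p ^ l ∣ Lk k) (hsl : 1 ≤ s + l) :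
    ¬ Function.Periodic (fun n => ∑ t ∈ Icc 2 (s + 1 + l), excess k a b c (p ^ t) n) (p ^ s) := by
  intro h
  have hcop : ∀ t, (p ^ t).Coprime a := fun t =>
    Nat.Coprime.pow_left _ ((Nat.Prime.coprime_iff_not_dvd hp).2 hpa)
  obtain ⟨n, hn⟩ := (hcop (s + 1 + l)).exists_dvd_add_mul (pow_pos hp.pos _).ne' b
  have hdvd : ∀ t ≤ s + 1 + l, p ^ t ∣ b + a * n := fun t ht => (pow_dvd_pow p ht).trans hn
  have hnd : ¬ p ^ (s + 1) ∣ b + a * (n + p ^ s) := by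
    rw [mul_add, ← add_assoc, Nat.dvd_add_right (hdvd _ (by omega))]
    intro h'
    have := (Nat.pow_dvd_pow_iff_le_right hp.one_lt).1 ((hcop _).dvd_of_dvd_mul_left h')
    omega
  have hzero : ∀ t, s + 1 ≤ t → excess k a b c (p ^ t) (n + p ^ s) = 0 := by
    intro t ht
    have h0 := hits_eq_zero_of_not_dvd (k := k) hc hnd
    have h1 : hits k a b c (p ^ t) (n + p ^ s) ≤ hits k a b c (p ^ (s + 1)) (n + p ^ s) :=
      card_le_card (monotone_filter_right _ fun i _ hi => (pow_dvd_pow p ht).trans hi)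
    unfold excess
    omega
  have hlt : ∑ t ∈ Icc 2 (s + 1 + l), excess k a b c (p ^ t) (n + p ^ s) <
      ∑ t ∈ Icc 2 (s + 1 + l), excess k a b c (p ^ t) n := by
    refine sum_lt_sum (fun t ht => ?_) ?_
    · rcases le_or_gt t s with hts | hts
      · exact (periodic_excess_of_dvd ((pow_dvd_pow p hts).mul_left a) n).le
      · rw [hzero t hts]
        exact Nat.zero_le _
    · rcases Nat.eq_zero_or_pos s with rfl | hs
      · refine ⟨2, mem_Icc.2 ⟨le_rfl, by omega⟩, ?_⟩
        rw [hzero 2 (by omega)]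
        have hpk := le_of_prime_pow_dvd_Lk hp one_ne_zero ((pow_dvd_pow p (by omega)).trans hl)
        rw [pow_one] at hpk
        refine one_le_excess hp.one_le hpk (hdvd 2 (by omega)) ?_
        rw [pow_two]
        exact mul_dvd_mul_left p (by simpa using hc)
      · refine ⟨s + 1, mem_Icc.2 ⟨by omega, by omega⟩, ?_⟩
        rw [hzero _ le_rfl]
        exact one_le_excess le_rfl hk (hdvd _ (by omega)) (hc.mul_left _)
  exact hlt.ne (h n)

theorem not_periodic_sum_excess_of_not_dvd {k a b c p m u l : ℕ} (hp : p.Prime)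
    (hpa : ¬ p ∣ a) (hpu : ¬ p ∣ u) (hc : c = p ^ m * u) (hl : p ^ (l + 1) ∣ Lk k)
    (hk : ¬ p ^ (l + 1) ∣ k + 1) (hml : 1 ≤ m + l) :
    ¬ Function.Periodic (fun n => ∑ t ∈ Icc 2 (m + l + 1), excess k a b c (p ^ t) n)
      (p ^ (m + l)) := by
  intro h
  have hpk := le_of_prime_pow_dvd_Lk hp (Nat.succ_ne_zero l) hl
  rw [pow_succ] at hpk hk
  refine not_periodic_excess (a := a) (b := b) hc (pow_pos hp.pos m) (pow_pos hp.pos l) hp.two_le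
    ?_ ?_ hpk hk ?_
  · rw [← pow_succ]
    exact Nat.Coprime.pow_left _ ((Nat.Prime.coprime_iff_not_dvd hp).2 (hp.not_dvd_mul hpa hpu))
  · rw [← pow_succ, ← pow_add]
    exact Nat.Coprime.pow_left _ ((Nat.Prime.coprime_iff_not_dvd hp).2 hpa)
  · rw [← pow_succ, ← pow_add, ← pow_add, ← add_assoc]
    intro n
    have h1 := h n
    have h2 : ∑ t ∈ Icc 2 (m + l), excess k a b c (p ^ t) (n + p ^ (m + l)) =
        ∑ t ∈ Icc 2 (m + l), excess k a b c (p ^ t) n :=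
      sum_congr rfl fun t ht =>
        periodic_excess_of_dvd ((pow_dvd_pow p (mem_Icc.1 ht).2).mul_left a) n
    simp only [sum_Icc_succ_top (show 2 ≤ m + l + 1 by omega), h2] at h1
    omega

theorem not_periodic_sum_excess_prime_pow {k a b c p m u s : ℕ} (hk : 1 ≤ k) (hp : p.Prime)
    (hpa : ¬ p ∣ a) (hpu : ¬ p ∣ u) (hc : c = p ^ m * u)
    (hs : (if m + padicValNat p (Lk k) = 1 then 0
      else if padicValNat p (Lk k) ≤ padicValNat p (k + 1) then m
      else m + padicValNat p (Lk k)) = s + 1) :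
    ¬ Function.Periodic
      (fun n => ∑ t ∈ Icc 2 (m + padicValNat p (Lk k)), excess k a b c (p ^ t) n) (p ^ s) := by
  have := Fact.mk hp
  have hl : p ^ padicValNat p (Lk k) ∣ Lk k := pow_padicValNat_dvd
  have hk1 : p ^ padicValNat p (Lk k) ∣ k + 1 ↔ padicValNat p (Lk k) ≤ padicValNat p (k + 1) :=
    padicValNat_dvd_iff_le (by omega)
  generalize padicValNat p (Lk k) = l at *
  split_ifs at hs with h1 h2
  · subst hs
    exact not_periodic_sum_excess_of_le hk hp hpa (hc ▸ dvd_mul_right _ _) hl (by omega)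
  · obtain ⟨l, rfl⟩ := Nat.exists_eq_succ_of_ne_zero (show l ≠ 0 by omega)
    obtain rfl : s = m + l := by omega
    exact not_periodic_sum_excess_of_not_dvd hp hpa hpu hc hl (mt hk1.1 h2) (by omega)

theorem not_periodic_excess_one {k a b c q : ℕ} (hk : 1 ≤ k) (hq : q.Prime) (hqa : ¬ q ∣ a)
    (h : q ∣ c ∨ ¬ q ∣ c ∧ q ∣ Lk k ∧ ¬ q ∣ k + 1) :
    ¬ Function.Periodic (excess k a b c q) 1 := by
  have hcop : q.Coprime a := (Nat.Prime.coprime_iff_not_dvd hq).2 hqa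
  rcases h with h | ⟨hqc, hqL, hqk⟩
  · intro hper
    obtain ⟨n, hn⟩ := hcop.exists_dvd_add_mul hq.ne_zero b
    have h1 := one_le_excess le_rfl hk hn (h.mul_left 1)
    have h2 : hits k a b c q (n + 1) = 0 := by
      refine hits_eq_zero_of_not_dvd h ?_
      rwa [mul_add, ← add_assoc, Nat.dvd_add_right hn, mul_one]
    have h3 := hper n
    unfold excess at h1 h3
    omega
  · have hqk' := le_of_prime_pow_dvd_Lk hq one_ne_zero (by simpa using hqL)
    simpa using not_periodic_excess (b := b) (one_mul c).symm one_pos one_pos hq.two_le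
      (by simpa using (Nat.Prime.coprime_iff_not_dvd hq).2 (hq.not_dvd_mul hqa hqc))
      (by simpa using hcop) (by simpa using hqk') (by simpa using hqk)

/-- Lemma 3.6: for a prime `p` with `p ∣ c L_k`, `p ∤ a'` and `p ∤ d`
(`d = gcd (a, b)`, `a' = a / d`), the smallest period of
`g_{p,k,φ} (n) = v_p (g_{k,φ} (n))` is `p ^ e (p, k)` times
`(∏_{q prime, q ∤ a c, q ∣ L_k, p ∣ q − 1, q ∤ k + 1} q) ⬝ (∏_{q prime, q ∤ a, q ∣ c, p ∣ q − 1} q)`,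
where `e (p, k) = 0` if `v_p (c L_k) = 1`, `e (p, k) = v_p (c)` if
`v_p (k + 1) ≥ v_p (L_k)` and `v_p (c L_k) ≥ 2`, and `e (p, k) = v_p (c L_k)` if
`v_p (k + 1) < v_p (L_k)` and `v_p (c L_k) ≥ 2`. -/
theorem smallest_local_period_not_dvd_a'_not_dvd_d (k a b c : ℕ)
    (hk : 1 ≤ k) (ha : 1 ≤ a) (hc : 1 ≤ c)
    (d a' : ℕ) (hd : d = Nat.gcd a b) (ha' : a' = a / d)
    (p : ℕ) (hp : p.Prime) (hpdvd : p ∣ c * Lk k) (hpa' : ¬ p ∣ a') (hpd : ¬ p ∣ d) :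
    IsLeast {T : ℕ | 0 < T ∧ ∀ n : ℕ, 0 < n →
        padicValRat p (gkphi k a b c (n + T)) = padicValRat p (gkphi k a b c n)}
      (p ^ (if padicValNat p (c * Lk k) = 1 then 0
            else if padicValNat p (Lk k) ≤ padicValNat p (k + 1) then padicValNat p c
            else padicValNat p (c * Lk k)) *
        ((∏ q ∈ (Lk k).divisors.filter
            (fun q => q.Prime ∧ ¬ q ∣ a * c ∧ p ∣ (q - 1) ∧ ¬ q ∣ (k + 1)), q) *
          ∏ q ∈ c.divisors.filter (fun q => q.Prime ∧ ¬ q ∣ a ∧ p ∣ (q - 1)), q)) := by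
  have := Fact.mk hp
  have hpa : ¬ p ∣ a := by
    have h : a = d * a' := by rw [ha', Nat.mul_div_cancel' (hd ▸ Nat.gcd_dvd_left a b)]
    rw [h]
    exact hp.not_dvd_mul hpd hpa'
  obtain ⟨m, u, hpu, hcu⟩ := Nat.exists_eq_pow_mul_and_not_dvd (by omega : c ≠ 0) p hp.ne_one
  have hu0 : u ≠ 0 := by
    rintro rfl
    exact hpu (dvd_zero p)
  have hvc : padicValNat p c = m := by
    rw [hcu, padicValNat.mul (pow_ne_zero _ hp.ne_zero) hu0, padicValNat.prime_pow,
      padicValNat.eq_zero_of_not_dvd hpu, add_zero]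
  have hvcL : padicValNat p (c * Lk k) = m + padicValNat p (Lk k) := by
    rw [padicValNat.mul (by omega) (Lk_ne_zero k), hvc]
  have hperF := periodic_sum_excess_prime_pow (k := k) (b := b) hp hpa hpu hcu
  have hnotF := fun s => not_periodic_sum_excess_prime_pow (b := b) (s := s) hk hp hpa hpu hcu
  have hval := fun n => padicValRat_gkphi (k := k) (b := b) (n := n) hp ha hc hpa
  rw [hvc, hvcL]
  rw [hvcL] at hval
  generalize (if m + padicValNat p (Lk k) = 1 then 0
    else if padicValNat p (Lk k) ≤ padicValNat p (k + 1) then m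
    else m + padicValNat p (Lk k)) = e at *
  set F : ℕ → ℕ := fun n => ∑ t ∈ Icc 2 (m + padicValNat p (Lk k)), excess k a b c (p ^ t) n
  set f : ℕ → ℕ → ℕ := fun q n => (q - 1).factorization p * excess k a b c q n with hf
  set S := (a * c * Lk k).primeFactors with hS
  rw [← prod_union (disjoint_left.2 fun q h1 h2 =>
    (mem_filter.1 h1).2.2.1 ((Nat.dvd_of_mem_divisors (mem_filter.1 h2).1).mul_left a))]
  set E := (Lk k).divisors.filter
      (fun q => q.Prime ∧ ¬ q ∣ a * c ∧ p ∣ (q - 1) ∧ ¬ q ∣ (k + 1)) ∪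
    c.divisors.filter (fun q => q.Prime ∧ ¬ q ∣ a ∧ p ∣ (q - 1)) with hEdef
  have hE : ∀ q, q ∈ E ↔ q.Prime ∧ p ∣ q - 1 ∧ ¬ q ∣ a ∧
      (q ∣ c ∨ ¬ q ∣ c ∧ q ∣ Lk k ∧ ¬ q ∣ k + 1) := by
    intro q
    simp only [hEdef, mem_union, mem_filter, Nat.mem_divisors]
    constructor
    · rintro (⟨⟨h1, _⟩, h2, h3, h4, h5⟩ | ⟨⟨h1, _⟩, h2, h3, h4⟩)
      · exact ⟨h2, h4, fun h => h3 (h.mul_right c), Or.inr ⟨fun h => h3 (h.mul_left a), h1, h5⟩⟩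
      · exact ⟨h2, h4, h3, Or.inl h1⟩
    · rintro ⟨h1, h2, h3, h4 | ⟨h4, h5, h6⟩⟩
      · exact Or.inr ⟨⟨h4, by omega⟩, h1, h3, h2⟩
      · exact Or.inl ⟨⟨h5, Lk_ne_zero k⟩, h1, h1.not_dvd_mul h3 h4, h2, h6⟩
  have hES : ∀ q ∈ E, q ∈ S := by
    intro q hq
    obtain ⟨h1, -, -, h4⟩ := (hE q).1 hq
    refine Nat.mem_primeFactors.2 ⟨h1, ?_, mul_ne_zero (by positivity) (Lk_ne_zero k)⟩
    rcases h4 with h4 | ⟨-, h4, -⟩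
    · exact (h4.mul_left a).mul_right _
    · exact h4.mul_left _
  have hpE : ∀ q ∈ E, q ≠ p := by
    rintro q hq rfl
    obtain ⟨h1, h2, -⟩ := (hE q).1 hq
    have := h1.two_le
    have := Nat.le_of_dvd (by omega) h2
    omega
  have hfone : ∀ q ∈ S, q ∉ E → Function.Periodic (f q) 1 := by
    intro q hq hqE
    by_cases h1 : p ∣ q - 1
    · have hex : Function.Periodic (excess k a b c q) 1 := by
        have hqp := Nat.prime_of_mem_primeFactors hq
        by_cases h2 : q ∣ a
        · exact periodic_excess_of_dvd (h2.mul_right 1)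
        have h3 : ¬ q ∣ c := fun h => hqE ((hE q).2 ⟨hqp, h1, h2, Or.inl h⟩)
        have h4 : q ∣ Lk k :=
          (hqp.dvd_mul.1 (Nat.dvd_of_mem_primeFactors hq)).resolve_left (hqp.not_dvd_mul h2 h3)
        have h5 : q ∣ k + 1 := by
          by_contra h5
          exact hqE ((hE q).2 ⟨hqp, h1, h2, Or.inr ⟨h3, h4, h5⟩⟩)
        simpa using periodic_excess_of_dvd_succ (b := b) (one_mul c).symm one_pos hqp.pos
          ((Nat.Prime.coprime_iff_not_dvd hqp).2 (hqp.not_dvd_mul h2 h3)) h5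
      intro n
      simp only [hf, hex n]
    · intro n
      simp only [hf, Nat.factorization_eq_zero_of_not_dvd h1, zero_mul]
  have hfdvd : ∀ q ∈ S, ∀ M, (q ∈ E → q ∣ M) → Function.Periodic (f q) M := by
    intro q hq M hM
    by_cases hqE : q ∈ E
    · intro n
      simp only [hf, periodic_excess_of_dvd ((hM hqE).mul_left a) n]
    · exact (hfone q hq hqE).of_dvd (one_dvd M)
  have hperR : Function.Periodic (fun n => ∑ q ∈ S, f q n) (∏ q ∈ E, q) :=
    Function.Periodic.finset_sum fun q hq => hfdvd q hq _ fun hqE => dvd_prod_of_mem _ hqE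
  have hperG : Function.Periodic (fun n => F n + ∑ q ∈ S, f q n) (p ^ e * ∏ q ∈ E, q) :=
    (hperF.of_dvd (dvd_mul_right _ _)).add (hperR.of_dvd (dvd_mul_left _ _))
  have hcop : p.Coprime (∏ q ∈ E, q) := Nat.Coprime.prod_right fun q hq =>
    (Nat.coprime_primes hp ((hE q).1 hq).1).2 (hpE q hq).symm
  have hpos : 0 < p ^ e * ∏ q ∈ E, q :=
    Nat.mul_pos (pow_pos hp.pos _) (prod_pos fun q hq => ((hE q).1 hq).1.pos)
  refine ⟨⟨hpos, fun n hn => ?_⟩, ?_⟩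
  · rw [hval n hn, hval _ (by omega), Nat.cast_inj]
    exact hperG n
  rintro T ⟨hT0, hT⟩
  have hGT : Function.Periodic (fun n => F n + ∑ q ∈ S, f q n) T := by
    intro n
    have h1 := hT (n + p ^ e * ∏ q ∈ E, q) (by omega)
    rw [hval _ (by omega), hval _ (by omega), Nat.cast_inj, add_right_comm] at h1
    exact ((hperG (n + T)).symm.trans h1).trans (hperG n)
  refine Nat.le_of_dvd hT0 ((hcop.pow_left e).mul_dvd_of_dvd_of_dvd ?_ ?_)
  · rcases e with _ | s
    · simp
    · by_contra hnd
      exact hnotF s rfl (hperF.of_add_of_coprime hp hperR hcop hGT hnd)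
  · refine prod_primes_dvd T (fun q hq => ((hE q).1 hq).1.prime) fun q hq => ?_
    obtain ⟨hqp, hpq, hqa, hor⟩ := (hE q).1 hq
    by_contra hnd
    have hfq : Function.Periodic (f q) (q ^ (0 + 1)) :=
      hfdvd q (hES q hq) _ fun _ => by simp
    have hrest : Function.Periodic (fun n => F n + ∑ r ∈ S.erase q, f r n)
        (p ^ e * ∏ r ∈ E.erase q, r) :=
      (hperF.of_dvd (dvd_mul_right _ _)).add <| Function.Periodic.finset_sum fun r hr =>
        hfdvd r (mem_of_mem_erase hr) _ fun hrE => (dvd_prod_of_mem _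
          (mem_erase.2 ⟨ne_of_mem_erase hr, hrE⟩)).mul_left _
    have hqcop : q.Coprime (p ^ e * ∏ r ∈ E.erase q, r) :=
      Nat.Coprime.mul_right (((Nat.coprime_primes hqp hp).2 (hpE q hq)).pow_right e) <|
        Nat.Coprime.prod_right fun r hr =>
          (Nat.coprime_primes hqp ((hE r).1 (mem_of_mem_erase hr)).1).2 (ne_of_mem_erase hr).symm
    have hsum : Function.Periodic (fun n => f q n + (F n + ∑ r ∈ S.erase q, f r n)) T := by
      have h : (fun n => f q n + (F n + ∑ r ∈ S.erase q, f r n)) =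
          fun n => F n + ∑ r ∈ S, f r n := by
        funext n
        rw [add_left_comm, add_sum_erase S (fun r => f r n) (hES q hq)]
      rw [h]
      exact hGT
    have hone := hfq.of_add_of_coprime hqp hrest hqcop hsum (by simpa using hnd)
    refine not_periodic_excess_one (b := b) hk hqp hqa hor fun n => ?_
    have hw := hp.factorization_pos_of_dvd (by have := hqp.two_le; omega) hpq
    exact Nat.eq_of_mul_eq_mul_left hw (hone n)
end
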